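/- arXiv:1309.7325 — 3 statements merged into one kernel-verified Lean document; each statement's English description precedes it below -/
import Mathlib

section
/- Let F be a field of characteristic different from 2 and let W be a Lie triple system over F, i.e. an F-vector space with a trilinear map (u,v,w) ↦ [u,v,w] = D(u,v)w satisfying: D(u,u) = 0; D(u,v)w + D(v,w)u + D(w,u)v = 0; and D(u,v)[x,y,z] = [D(u,v)x,y,z] + [x,D(u,v)y,z] + [x,y,D(u,v)z] for all u,v,w,x,y,z ∈ W. Then the F-vector space Der(W) ⊕ W, where Der(W) is the space of derivations of W, equipped with the bracket [(D,u),(E,v)] = ([D,E] + D(u,v), Dv − Eu) (note D(u,v) ∈ Der(W) by the third axiom), is a Lie algebra over F: the bracket is bilinear, alternating, and satisfies the Jacobi identity. Moreover, for u,v,w ∈ W (viewed in the second summand) the iterated bracket [[ (0,u),(0,v) ], (0,w)] equals (0, [u,v,w]), so the triple commutator on W recovers the original triple product. -/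
/-- A derivation of a triple system `(W, T)`: a linear endomorphism satisfying the
Leibniz rule with respect to the triple product. -/
def IsTripleDerivation {F : Type*} [Field F] {W : Type*} [AddCommGroup W] [Module F W]
    (T : W →ₗ[F] W →ₗ[F] W →ₗ[F] W) (D : Module.End F W) : Prop :=
  ∀ x y z : W, D (T x y z) = T (D x) y z + T x (D y) z + T x y (D z)

namespace IsTripleDerivation

variable {F : Type*} [Field F] {W : Type*} [AddCommGroup W] [Module F W]
  {T : W →ₗ[F] W →ₗ[F] W →ₗ[F] W} {D E : Module.End F W}

theorem add (hD : IsTripleDerivation T D) (hE : IsTripleDerivation T E) :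
    IsTripleDerivation T (D + E) := by
  intro x y z
  simp only [LinearMap.add_apply, map_add, hD x y z, hE x y z]
  abel

theorem lie (hD : IsTripleDerivation T D) (hE : IsTripleDerivation T E) :
    IsTripleDerivation T ⁅D, E⁆ := by
  intro x y z
  simp only [Ring.lie_def, LinearMap.sub_apply, Module.End.mul_apply, map_sub, map_add,
    hD _ _ _, hE _ _ _]
  abel

/-- Equivalently, `⁅D, T u v⁆ = T (D u) v + T u (D v)`. -/
theorem mul_apply_apply (hD : IsTripleDerivation T D) (u v : W) :
    D * T u v = T u v * D + (T (D u) v + T u (D v)) := by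
  ext w
  simp only [Module.End.mul_apply, LinearMap.add_apply, hD u v w]
  abel

end IsTripleDerivation

/-- If `(W, T)` is a Lie triple system over a field `F` of characteristic ≠ 2,
then `Der(W) ⊕ W` with the bracket `[(D,u),(E,v)] = ([D,E] + D(u,v), Dv − Eu)` is a Lie
algebra: the bracket is bilinear, alternating, preserves the subspace where the first
component is a derivation (note `D(u,v) = T u v` is a derivation by the third axiom), and
satisfies the Jacobi identity there; moreover the triple bracket of elements of `W` recovers
the original triple product. -/
theorem embedding_lie_algebra_of_lie_triple_system
    (F : Type*) [Field F] (hchar : (2 : F) ≠ 0)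
    (W : Type*) [AddCommGroup W] [Module F W]
    (T : W →ₗ[F] W →ₗ[F] W →ₗ[F] W)
    (ax1 : ∀ u w : W, T u u w = 0)
    (ax2 : ∀ u v w : W, T u v w + T v w u + T w u v = 0)
    (ax3 : ∀ u v x y z : W,
      T u v (T x y z) = T (T u v x) y z + T x (T u v y) z + T x y (T u v z))
    (br : Module.End F W × W → Module.End F W × W → Module.End F W × W)
    (hbr : ∀ (D E : Module.End F W) (u v : W),
      br (D, u) (E, v) = (⁅D, E⁆ + (T u v : Module.End F W), D v - E u)) :
    -- bilinearity
    (∀ x y z : Module.End F W × W, br (x + y) z = br x z + br y z) ∧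
    (∀ (c : F) (x z : Module.End F W × W), br (c • x) z = c • br x z) ∧
    (∀ x y z : Module.End F W × W, br x (y + z) = br x y + br x z) ∧
    (∀ (c : F) (x y : Module.End F W × W), br x (c • y) = c • br x y) ∧
    -- alternating
    (∀ x : Module.End F W × W, br x x = 0) ∧
    -- Der(W) ⊕ W is closed under the bracket
    (∀ x y : Module.End F W × W, IsTripleDerivation T x.1 → IsTripleDerivation T y.1 →
      IsTripleDerivation T (br x y).1) ∧
    -- Jacobi identity on Der(W) ⊕ W
    (∀ x y z : Module.End F W × W,
      IsTripleDerivation T x.1 → IsTripleDerivation T y.1 → IsTripleDerivation T z.1 →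
      br (br x y) z + br (br y z) x + br (br z x) y = 0) ∧
    -- the triple commutator on W recovers the triple product
    (∀ u v w : W,
      br (br ((0 : Module.End F W), u) ((0 : Module.End F W), v))
        ((0 : Module.End F W), w) = ((0 : Module.End F W), T u v w)) := by
  have alt : T.IsAlt := fun u => LinearMap.ext (ax1 u)
  have inner (u v : W) : IsTripleDerivation T (T u v) := ax3 u v
  refine ⟨?_, ?_, ?_, ?_, ?_, ?_, ?_, ?_⟩
  · rintro ⟨D, u⟩ ⟨E, v⟩ ⟨G, w⟩
    simp only [Prod.mk_add_mk, hbr, Ring.lie_def, add_mul, mul_add, map_add,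
      LinearMap.add_apply, Prod.mk.injEq]
    constructor <;> abel
  · rintro c ⟨D, u⟩ ⟨E, v⟩
    simp only [Prod.smul_mk, hbr, Ring.lie_def, smul_mul_assoc, mul_smul_comm, map_smul,
      LinearMap.smul_apply, smul_add, smul_sub]
  · rintro ⟨D, u⟩ ⟨E, v⟩ ⟨G, w⟩
    simp only [Prod.mk_add_mk, hbr, Ring.lie_def, add_mul, mul_add, map_add,
      LinearMap.add_apply, Prod.mk.injEq]
    constructor <;> abel
  · rintro c ⟨D, u⟩ ⟨E, v⟩
    simp only [Prod.smul_mk, hbr, Ring.lie_def, smul_mul_assoc, mul_smul_comm, map_smul,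
      LinearMap.smul_apply, smul_add, smul_sub]
  · rintro ⟨D, u⟩
    simp only [hbr, Ring.lie_def, alt u, add_zero, sub_self, Prod.mk_eq_zero, and_self]
  · rintro ⟨D, u⟩ ⟨E, v⟩ hD hE
    rw [hbr]
    exact (hD.lie hE).add (inner u v)
  · rintro ⟨D, u⟩ ⟨E, v⟩ ⟨G, w⟩ hD hE hG
    simp only [hbr, Prod.mk_add_mk, Prod.mk_eq_zero]
    constructor
    · simp only [Ring.lie_def, add_mul, mul_add, sub_mul, mul_sub, ← mul_assoc, map_sub,
        LinearMap.sub_apply, hD.mul_apply_apply v w, hE.mul_apply_apply w u,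
        hG.mul_apply_apply u v, ← alt.neg v (D w), ← alt.neg w (E u), ← alt.neg u (G v)]
      abel
    · simp only [Ring.lie_def, LinearMap.add_apply, LinearMap.sub_apply, Module.End.mul_apply,
        map_sub]
      rw [← ax2 u v w]
      abel
  · intro u v w
    simp only [hbr, Ring.lie_def, mul_zero, zero_mul, sub_self, zero_add, add_zero,
      LinearMap.zero_apply, sub_zero, map_zero]
end

section
/- Let F be a field of characteristic different from 2, V an F-vector space, and ⟨·,·⟩ : V × V → F an alternating bilinear form (⟨u,u⟩ = 0 for all u). Define Φ : (V × V) × (V × V) → M₂(F) by Φ((u₁,u₂),(v₁,v₂)) = [[⟨u₁,v₂⟩, −⟨u₁,v₁⟩],[⟨u₂,v₂⟩, −⟨u₂,v₁⟩]]. Let M₂(F) act on V × V by m·(u₁,u₂) = (m₁₁u₁ + m₁₂u₂, m₂₁u₁ + m₂₂u₂), and let σ denote the canonical symplectic involution on M₂(F), σ(m) = tr(m)·1 − m. Then Φ is a Hermitian form with respect to σ: (a) Φ(m·x, y) = m·Φ(x,y) for all m ∈ M₂(F) and x,y ∈ V × V; and (b) Φ(y,x) = σ(Φ(x,y)) for all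 x,y ∈ V × V. -/
/-- Let `V` be a vector space over a field `F` of characteristic ≠ 2 with an
alternating bilinear form `b`. The `M₂(F)`-valued form
`Φ((u₁,u₂),(v₁,v₂)) = [[b u₁ v₂, −b u₁ v₁], [b u₂ v₂, −b u₂ v₁]]` on `V × V ≅ F² ⊗ V`
is Hermitian with respect to the canonical symplectic involution `σ(m) = tr(m)·1 − m`:
it is additive in each argument, `Φ(m·x, y) = m·Φ(x,y)`, and `Φ(y,x) = σ(Φ(x,y))`. -/
theorem hermitian_form_on_two_copies
    (F : Type*) [Field F] (hchar : (2 : F) ≠ 0)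
    (V : Type*) [AddCommGroup V] [Module F V]
    (b : V →ₗ[F] V →ₗ[F] F) (halt : ∀ u : V, b u u = 0)
    (Φ : V × V → V × V → Matrix (Fin 2) (Fin 2) F)
    (hΦ : ∀ u₁ u₂ v₁ v₂ : V,
      Φ (u₁, u₂) (v₁, v₂) = !![b u₁ v₂, -(b u₁ v₁); b u₂ v₂, -(b u₂ v₁)])
    (act : Matrix (Fin 2) (Fin 2) F → V × V → V × V)
    (hact : ∀ (m : Matrix (Fin 2) (Fin 2) F) (x : V × V),
      act m x = (m 0 0 • x.1 + m 0 1 • x.2, m 1 0 • x.1 + m 1 1 • x.2))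
    (σ : Matrix (Fin 2) (Fin 2) F → Matrix (Fin 2) (Fin 2) F)
    (hσ : ∀ m : Matrix (Fin 2) (Fin 2) F,
      σ m = Matrix.trace m • (1 : Matrix (Fin 2) (Fin 2) F) - m) :
    -- Φ is additive in each argument
    (∀ x x' y : V × V, Φ (x + x') y = Φ x y + Φ x' y) ∧
    (∀ x y y' : V × V, Φ x (y + y') = Φ x y + Φ x y') ∧
    -- (a) Φ(m·x, y) = m·Φ(x, y)
    (∀ (m : Matrix (Fin 2) (Fin 2) F) (x y : V × V), Φ (act m x) y = m * Φ x y) ∧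
    -- (b) Φ(y, x) = σ(Φ(x, y))
    (∀ x y : V × V, Φ y x = σ (Φ x y)) := by
  have hskew : ∀ u v : V, b v u = -(b u v) := fun u v =>
    (LinearMap.IsAlt.neg (B := b) halt u v).symm
  refine ⟨?_, ?_, ?_, ?_⟩
  · rintro ⟨u₁, u₂⟩ ⟨u₁', u₂'⟩ ⟨v₁, v₂⟩
    ext i j
    fin_cases i <;> fin_cases j <;> simp [hΦ] <;> ring
  · rintro ⟨u₁, u₂⟩ ⟨v₁, v₂⟩ ⟨v₁', v₂'⟩
    ext i j
    fin_cases i <;> fin_cases j <;> simp [hΦ] <;> ring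
  · rintro m ⟨u₁, u₂⟩ ⟨v₁, v₂⟩
    ext i j
    fin_cases i <;> fin_cases j <;>
      simp [hΦ, hact, Matrix.mul_apply, Fin.sum_univ_two] <;> ring
  · rintro ⟨u₁, u₂⟩ ⟨v₁, v₂⟩
    rw [hσ, hΦ, hΦ, hskew u₂ v₁, hskew u₁ v₁, hskew u₂ v₂, hskew u₁ v₂]
    ext i j
    fin_cases i <;> fin_cases j <;> simp [Matrix.trace_fin_two]
end

section
/- Let P (points) and L (lines) be a finite projective plane of order 2 (the Fano plane). Let α and β be two distinct lines, with complements C_α = {p : p ∉ α} and C_β = {p : p ∉ β}. Then there exists a (unique) line γ whose complement C_γ equals the symmetric difference C_α Δ C_β = (C_α ∪ C_β) \ (C_α ∩ C_β); moreover the three lines α, β, γ are concurrent: the unique intersection point of α and β also lies on γ. -/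
open Configuration

theorem exists_third_line_through {P L : Type*} [Membership P L] [Finite P] [Finite L]
    [ProjectivePlane P L] (hord : ProjectivePlane.order P L = 2) {α β : L} (hαβ : α ≠ β)
    {o : P} (hoα : o ∈ α) (hoβ : o ∈ β) :
    ∃ γ : L, γ ≠ α ∧ γ ≠ β ∧ ∀ l : L, o ∈ l ↔ l = α ∨ l = β ∨ l = γ := by
  have hcard : {l : L | o ∈ l}.ncard = 3 :=
    (ProjectivePlane.lineCount_eq (L := L) o).trans (by rw [hord])
  have hsub : {α, β} ⊆ {l : L | o ∈ l} := by simp [Set.insert_subset_iff, hoα, hoβ]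
  have hdiff := Set.ncard_sdiff_add_ncard_of_subset hsub
  rw [hcard, Set.ncard_pair hαβ] at hdiff
  obtain ⟨γ, hγ⟩ := Set.ncard_eq_one.mp (Nat.add_right_cancel (m := 2) hdiff)
  have h : ∀ l : L, (o ∈ l ∧ ¬(l = α ∨ l = β)) ↔ l = γ := fun l => by
    simpa using Set.ext_iff.mp hγ l
  exact ⟨γ, fun e => ((h γ).mpr rfl).2 (.inl e), fun e => ((h γ).mpr rfl).2 (.inr e),
    fun l => by grind⟩

theorem line_ext {P L : Type*} [Membership P L] [Finite P] [Finite L]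
    [ProjectivePlane P L] {l m : L} (h : ∀ p : P, p ∈ l ↔ p ∈ m) : l = m := by
  have hcard : 1 < Nat.card {p : P // p ∈ l} :=
    lt_trans one_lt_two (ProjectivePlane.two_lt_pointCount (P := P) l)
  have := Finite.one_lt_card_iff_nontrivial.mp hcard
  obtain ⟨⟨p, hp⟩, ⟨q, hq⟩, hpq⟩ := exists_pair_ne {p : P // p ∈ l}
  exact (Nondegenerate.eq_or_eq hp hq ((h p).mp hp) ((h q).mp hq)).resolve_left
    fun e => hpq (Subtype.ext e)

theorem exists_sum_line {P L : Type*} [Membership P L] [Finite P] [Finite L]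
    [ProjectivePlane P L] (hord : ProjectivePlane.order P L = 2) {α β : L} (hαβ : α ≠ β) :
    ∃ γ : L, ∀ p : P, p ∈ γ ↔ (p ∈ α ↔ p ∈ β) := by
  obtain ⟨hoα, hoβ⟩ := HasPoints.mkPoint_ax (P := P) hαβ
  generalize HasPoints.mkPoint (P := P) hαβ = o at hoα hoβ
  obtain ⟨γ, hγα, hγβ, h⟩ := exists_third_line_through hord hαβ hoα hoβ
  have hoγ : o ∈ γ := by simp [h]
  refine ⟨γ, fun p => ?_⟩
  by_cases hp : p = o
  · simp [hp, hoα, hoβ, hoγ]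
  obtain ⟨m, ⟨hpm, hom⟩, -⟩ := HasLines.existsUnique_line P L p o hp
  have unique : ∀ l : L, o ∈ l → (p ∈ l ↔ l = m) := fun l hol =>
    ⟨fun hpl => (Nondegenerate.eq_or_eq hpl hol hpm hom).resolve_left hp, fun e => e ▸ hpm⟩
  rw [unique γ hoγ, unique α hoα, unique β hoβ]
  have hm := (h m).mp hom
  grind

/-- In a projective plane of order 2 (the Fano plane), for two distinct lines
`α`, `β` with complements `C_α`, `C_β`, there is a unique line `γ` whose complement is the
symmetric difference `(C_α ∪ C_β) \ (C_α ∩ C_β)`; moreover `α`, `β`, `γ` are concurrent: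
every common point of `α` and `β` lies on `γ`. -/
theorem fano_sum_of_lines
    (P L : Type*) [Membership P L] [Fintype P] [Fintype L] [DecidableEq P]
    [ProjectivePlane P L] [∀ (p : P) (l : L), Decidable (p ∈ l)]
    (hord : ProjectivePlane.order P L = 2)
    (α β : L) (hαβ : α ≠ β) :
    (∃! γ : L, Finset.univ.filter (fun p : P => p ∉ γ) =
        ((Finset.univ.filter (fun p : P => p ∉ α)) ∪
          (Finset.univ.filter (fun p : P => p ∉ β))) \
        ((Finset.univ.filter (fun p : P => p ∉ α)) ∩
          (Finset.univ.filter (fun p : P => p ∉ β)))) ∧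
    (∀ γ : L, Finset.univ.filter (fun p : P => p ∉ γ) =
        ((Finset.univ.filter (fun p : P => p ∉ α)) ∪
          (Finset.univ.filter (fun p : P => p ∉ β))) \
        ((Finset.univ.filter (fun p : P => p ∉ α)) ∩
          (Finset.univ.filter (fun p : P => p ∉ β))) →
      ∀ p : P, p ∈ α → p ∈ β → p ∈ γ) := by
  have key : ∀ γ : L, Finset.univ.filter (fun p : P => p ∉ γ) =
        ((Finset.univ.filter (fun p : P => p ∉ α)) ∪
          (Finset.univ.filter (fun p : P => p ∉ β))) \
        ((Finset.univ.filter (fun p : P => p ∉ α)) ∩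
          (Finset.univ.filter (fun p : P => p ∉ β))) ↔
      ∀ p : P, p ∈ γ ↔ (p ∈ α ↔ p ∈ β) := fun γ => by
    simp only [Finset.ext_iff, Finset.mem_filter, Finset.mem_univ, true_and, Finset.mem_sdiff,
      Finset.mem_union, Finset.mem_inter]
    exact forall_congr' fun p => by tauto
  simp only [key]
  refine ⟨?_, fun γ hγ p hα hβ => (hγ p).mpr (iff_of_true hα hβ)⟩
  obtain ⟨γ, hγ⟩ := exists_sum_line (P := P) hord hαβ
  exact ⟨γ, hγ, fun δ hδ => line_ext fun p => (hδ p).trans (hγ p).symm⟩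
end
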